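/- Let H ⊆ ℋ be a factorial standard subspace, with D = D_H, J = J_H, and H^⊥ the orthogonal complement of H with respect to α = Re(·,·). In the symplectic matrix decomposition relative to H + H' one has: E_H = [[1, √(1+D²)J], [0, 0]], E_{H^⊥} = [[0, −√(1+D²)J], [0, 1]], and E_{H'} = [[0, 0], [J√(1+D²), 1]]. -/

import Mathlib

/-!
Statement 10: symplectic matrix decompositions (relative to `H + H'`) of the real
orthogonal projections `E_H`, `E_{H^⊥}`, `E_{H'}`:
`E_H = [[1, √(1+D²) J], [0, 0]]`, `E_{H^⊥} = [[0, −√(1+D²) J], [0, 1]]`,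
`E_{H'} = [[0, 0], [J √(1+D²), 1]]`.
Pointwise: for `h ∈ H`, `h' ∈ H'` (with `J h' ∈ H`):
`E_H (h + h') = h + Q (J h')`, `E_{H^⊥} (h + h') = −Q (J h') + h'`,
`E_{H'} (h + h') = J (Q h) + h'`, where `Q = √(1+D²)`.
-/
open scoped InnerProductSpace

attribute [local instance] InnerProductSpace.complexToReal

noncomputable section

/-- Multiplication by `Complex.I`, as a real-linear map. -/
def mulI (ℋ : Type) [NormedAddCommGroup ℋ] [InnerProductSpace ℂ ℋ] : ℋ →ₗ[ℝ] ℋ :=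
  (Complex.I • (LinearMap.id : ℋ →ₗ[ℂ] ℋ)).restrictScalars ℝ

/-- The symplectic complement `H' = (iH)^⊥`, the orthogonal complement of `iH` with
respect to the real part of the inner product. -/
def sympComp {ℋ : Type} [NormedAddCommGroup ℋ] [InnerProductSpace ℂ ℋ]
    (H : Submodule ℝ ℋ) : Submodule ℝ ℋ :=
  (H.map (mulI ℋ))ᗮ

/-- Encoding of the modular data `(Δ_H, J_H)` of a standard subspace `H`:
`R = (1 + Δ_H)⁻¹` (a positive injective contraction with `1 - R` injective),
`W = Δ_H^{1/2} (1 + Δ_H)⁻¹` (the positive square root of `R - R²`), and the modular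
conjugation `J = J_H` (a conjugate-linear isometric involution with `J Δ J = Δ⁻¹`,
i.e. `J R J = 1 - R`, and `J W = W J`).  The subspace `H` is recovered through the
formula `E_H = (1 + Δ_H)⁻¹ + J_H Δ_H^{1/2} (1 + Δ_H)⁻¹`, i.e. `x ∈ H ↔ R x + J W x = x`;
moreover `J_H H = H'`. -/
structure ModularData (ℋ : Type) [NormedAddCommGroup ℋ] [InnerProductSpace ℂ ℋ]
    (H : Submodule ℝ ℋ) : Type where
  R : ℋ →L[ℂ] ℋ
  W : ℋ →L[ℂ] ℋ
  J : ℋ →ₗ[ℝ] ℋ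
  R_sa : ∀ x y : ℋ, ⟪R x, y⟫_ℂ = ⟪x, R y⟫_ℂ
  R_pos : ∀ x : ℋ, 0 ≤ (⟪x, R x⟫_ℂ).re
  R_le_one : ∀ x : ℋ, (⟪x, R x⟫_ℂ).re ≤ ‖x‖ ^ 2
  R_inj : ∀ x : ℋ, R x = 0 → x = 0
  oneSubR_inj : ∀ x : ℋ, R x = x → x = 0
  W_sa : ∀ x y : ℋ, ⟪W x, y⟫_ℂ = ⟪x, W y⟫_ℂ
  W_pos : ∀ x : ℋ, 0 ≤ (⟪x, W x⟫_ℂ).re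
  W_sq : ∀ x : ℋ, W (W x) = R x - R (R x)
  WR_comm : ∀ x : ℋ, W (R x) = R (W x)
  J_conjI : ∀ x : ℋ, J (Complex.I • x) = -(Complex.I • J x)
  J_isom : ∀ x : ℋ, ‖J x‖ = ‖x‖
  J_invol : ∀ x : ℋ, J (J x) = x
  J_R : ∀ x : ℋ, J (R x) = J x - R (J x)
  J_W : ∀ x : ℋ, J (W x) = W (J x)
  memH_iff : ∀ x : ℋ, x ∈ H ↔ R x + J (W x) = x
  J_mapsH : ∀ x ∈ H, J x ∈ sympComp H
  J_mapsH' : ∀ x ∈ sympComp H, J x ∈ H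

/-- Real-orthogonal projection onto the closed real subspace `K`. -/
def IsOrthProj {ℋ : Type} [NormedAddCommGroup ℋ] [InnerProductSpace ℂ ℋ]
    (K : Submodule ℝ ℋ) (E : ℋ →ₗ[ℝ] ℋ) : Prop :=
  (∀ x : ℋ, E x ∈ K) ∧ (∀ x ∈ K, E x = x) ∧ ∀ (x : ℋ), ∀ k ∈ K, ⟪x - E x, k⟫_ℝ = 0


/-- Uniqueness of positive square roots on a real inner product space. -/
theorem aux_pos_sqrt_unique {V : Type} [NormedAddCommGroup V] [InnerProductSpace ℝ V]
    (A B : V →L[ℝ] V)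
    (hAs : ∀ x y, ⟪A x, y⟫_ℝ = ⟪x, A y⟫_ℝ) (hBs : ∀ x y, ⟪B x, y⟫_ℝ = ⟪x, B y⟫_ℝ)
    (hAp : ∀ x, 0 ≤ ⟪x, A x⟫_ℝ) (hBp : ∀ x, 0 ≤ ⟪x, B x⟫_ℝ)
    (hsq : ∀ x, A (A x) = B (B x)) : A = B := by
  by_contra hne
  set X : V →L[ℝ] V := A - B with hX
  set S : V →L[ℝ] V := A + B with hS
  have hX0 : X ≠ 0 := fun h => hne (sub_eq_zero.mp h)
  have hL : 0 < ‖X‖ := norm_pos_iff.mpr hX0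
  have hXs : ∀ x y, ⟪X x, y⟫_ℝ = ⟪x, X y⟫_ℝ := by
    intro x y
    simp [hX, inner_sub_left, inner_sub_right, hAs, hBs]
  have hSs : ∀ x y, ⟪S x, y⟫_ℝ = ⟪x, S y⟫_ℝ := by
    intro x y
    simp [hS, inner_add_left, inner_add_right, hAs, hBs]
  have hXS : ∀ x, S (X x) = - X (S x) := by
    intro x
    simp only [hX, hS, ContinuousLinearMap.add_apply, ContinuousLinearMap.sub_apply, map_add,
      map_sub, hsq]
    abel
  have hle : ∀ z, ⟪z, X z⟫_ℝ ≤ ⟪z, S z⟫_ℝ := by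
    intro z
    have := hBp z
    simp only [hX, hS, ContinuousLinearMap.add_apply, ContinuousLinearMap.sub_apply,
      inner_add_right, inner_sub_right]
    linarith
  have hle' : ∀ z, -⟪z, X z⟫_ℝ ≤ ⟪z, S z⟫_ℝ := by
    intro z
    have := hAp z
    simp only [hX, hS, ContinuousLinearMap.add_apply, ContinuousLinearMap.sub_apply,
      inner_add_right, inner_sub_right]
    linarith
  have hpol : ∀ x y, 2 * ⟪X x, y⟫_ℝ ≤ ⟪x, S x⟫_ℝ + ⟪y, S y⟫_ℝ := by
    intro x y
    have h1 := hle (x + y)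
    have h2 := hle' (x - y)
    simp only [map_add, map_sub, inner_add_left, inner_add_right, inner_sub_left,
      inner_sub_right] at h1 h2
    have h3 : ⟪y, X x⟫_ℝ = ⟪X x, y⟫_ℝ := real_inner_comm _ _
    have h4 : ⟪x, X y⟫_ℝ = ⟪X x, y⟫_ℝ := (hXs x y).symm
    rw [h3, h4] at h1 h2
    linarith
  set L := ‖X‖ with hLdef
  set K := ‖S‖ with hKdef
  have hK0 : 0 ≤ K := norm_nonneg _
  -- main estimate
  have key : ∀ x, 4 * (‖X x‖ ^ 2) ^ 2 ≤ K ^ 2 * ‖x‖ ^ 2 * (L ^ 2 * ‖x‖ ^ 2 - ‖X x‖ ^ 2) := by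
    intro x
    have h1 := hpol (L • x) (X x)
    have h2 : ⟪X x, S (X x)⟫_ℝ = - ⟪S x, X (X x)⟫_ℝ := by
      rw [hXS, inner_neg_right, ← hXs (X x), real_inner_comm]
    have h3 : 2 * L * ‖X x‖ ^ 2 ≤ ⟪S x, L ^ 2 • x - X (X x)⟫_ℝ := by
      rw [h2] at h1
      simp only [map_smul, inner_smul_left, inner_smul_right, real_inner_self_eq_norm_sq] at h1
      rw [inner_sub_right, inner_smul_right, hSs]
      simp at h1
      nlinarith
    have h4 : 2 * L * ‖X x‖ ^ 2 ≤ K * ‖x‖ * ‖L ^ 2 • x - X (X x)‖ := by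
      refine h3.trans ((real_inner_le_norm _ _).trans ?_)
      gcongr
      exact S.le_opNorm x
    have h5 : ‖L ^ 2 • x - X (X x)‖ ^ 2 ≤ L ^ 2 * (L ^ 2 * ‖x‖ ^ 2 - ‖X x‖ ^ 2) := by
      rw [norm_sub_sq_real, inner_smul_left, ← hXs, real_inner_self_eq_norm_sq, norm_smul]
      have h6 : ‖X (X x)‖ ≤ L * ‖X x‖ := X.le_opNorm _
      have h7 : ‖X (X x)‖ ^ 2 ≤ (L * ‖X x‖) ^ 2 := by gcongr
      simp
      nlinarith
    have h8 : (2 * L * ‖X x‖ ^ 2) ^ 2 ≤ (K * ‖x‖ * ‖L ^ 2 • x - X (X x)‖) ^ 2 := by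
      gcongr
    have h9 : L ^ 2 * (4 * (‖X x‖ ^ 2) ^ 2) ≤
        L ^ 2 * (K ^ 2 * ‖x‖ ^ 2 * (L ^ 2 * ‖x‖ ^ 2 - ‖X x‖ ^ 2)) := by
      calc _ = (2 * L * ‖X x‖ ^ 2) ^ 2 := by ring
        _ ≤ _ := h8
        _ = (K ^ 2 * ‖x‖ ^ 2) * ‖L ^ 2 • x - X (X x)‖ ^ 2 := by ring
        _ ≤ (K ^ 2 * ‖x‖ ^ 2) * (L ^ 2 * (L ^ 2 * ‖x‖ ^ 2 - ‖X x‖ ^ 2)) := by gcongr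
        _ = _ := by ring
    exact le_of_mul_le_mul_left h9 (by positivity)
  -- contraction factor
  set M := K ^ 2 + 4 * L ^ 2 with hM
  have hMpos : 0 < M := by positivity
  have hbd : ∀ x, ‖X x‖ ^ 2 ≤ L ^ 2 * (1 - L ^ 2 / M) * ‖x‖ ^ 2 := by
    intro x
    have hk := key x
    have hu : ‖X x‖ ^ 2 ≤ L ^ 2 * ‖x‖ ^ 2 := by
      rw [← mul_pow]; gcongr; exact X.le_opNorm x
    by_contra hcon
    push Not at hcon
    set n := ‖x‖ ^ 2 with hn
    set u := ‖X x‖ ^ 2 with hudef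
    have hn0 : 0 ≤ n := by positivity
    have hLM : L ^ 2 / M ≤ 1 / 4 := by
      rw [div_le_div_iff₀ hMpos (by norm_num)]; nlinarith [sq_nonneg K]
    have hnpos : 0 < n := by
      rcases hn0.lt_or_eq with h | h
      · exact h
      · rw [← h] at hcon hu; simp at hcon hu; linarith
    have e : M * (L ^ 2 / M) = L ^ 2 := by field_simp
    have hKe : K ^ 2 * (L ^ 2 / M) ≤ L ^ 2 := by
      have : 0 ≤ L ^ 2 / M := by positivity
      nlinarith [sq_nonneg L]
    have h1 : L ^ 2 * n - u ≤ L ^ 2 * (L ^ 2 / M) * n := by nlinarith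
    have h2 : 4 * u ^ 2 ≤ L ^ 2 * L ^ 2 * n ^ 2 := by
      calc 4 * u ^ 2 ≤ K ^ 2 * n * (L ^ 2 * n - u) := hk
        _ ≤ K ^ 2 * n * (L ^ 2 * (L ^ 2 / M) * n) := by gcongr
        _ = (K ^ 2 * (L ^ 2 / M)) * (L ^ 2 * n ^ 2) := by ring
        _ ≤ L ^ 2 * (L ^ 2 * n ^ 2) := by gcongr
        _ = _ := by ring
    have h3 : L ^ 2 * (3 / 4) * n < u := by
      refine lt_of_le_of_lt ?_ hcon
      gcongr
      linarith
    have h4 : (L ^ 2 * (3 / 4) * n) ^ 2 < u ^ 2 := by gcongr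
    have h5 : 0 < L ^ 2 * L ^ 2 * n ^ 2 := by positivity
    nlinarith
  have hθ : 0 ≤ 1 - L ^ 2 / M := by
    have : L ^ 2 / M ≤ 1 := by
      rw [div_le_one hMpos]; nlinarith [sq_nonneg K]
    linarith
  have hfin : L ≤ L * √(1 - L ^ 2 / M) := by
    refine X.opNorm_le_bound (by positivity) fun x => ?_
    have := hbd x
    refine le_of_sq_le_sq ?_ (by positivity)
    rw [mul_pow, mul_pow, Real.sq_sqrt hθ]
    exact this
  have hlt : √(1 - L ^ 2 / M) < 1 := by
    rw [Real.sqrt_lt' one_pos]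
    have : 0 < L ^ 2 / M := by positivity
    linarith
  nlinarith

section ModularAux

variable {ℋ : Type} [NormedAddCommGroup ℋ] [InnerProductSpace ℂ ℋ] {H : Submodule ℝ ℋ}

theorem aux_J_sym (md : ModularData ℋ H) (x y : ℋ) : ⟪md.J x, y⟫_ℝ = ⟪x, md.J y⟫_ℝ := by
  let U : ℋ →ₗᵢ[ℝ] ℋ := ⟨md.J, md.J_isom⟩
  have h : ⟪md.J x, md.J (md.J y)⟫_ℝ = ⟪x, md.J y⟫_ℝ := U.inner_map_map x (md.J y)
  rwa [md.J_invol] at h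

theorem aux_R_sym (md : ModularData ℋ H) (x y : ℋ) : ⟪md.R x, y⟫_ℝ = ⟪x, md.R y⟫_ℝ := by
  simp only [real_inner_eq_re_inner ℂ, md.R_sa]

theorem aux_W_sym (md : ModularData ℋ H) (x y : ℋ) : ⟪md.W x, y⟫_ℝ = ⟪x, md.W y⟫_ℝ := by
  simp only [real_inner_eq_re_inner ℂ, md.W_sa]

theorem aux_RJ (md : ModularData ℋ H) {k : ℋ} (hk : k ∈ H) : md.R (md.J k) = md.W k := by
  have h1 := md.J_R k
  have h2 := congrArg md.J ((md.memH_iff k).1 hk)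
  rw [map_add, md.J_invol, h1] at h2
  have h3 : md.J k - md.R (md.J k) + md.W k - md.J k = 0 := by rw [h2, sub_self]
  have h4 : md.W k - md.R (md.J k) = 0 := by rw [← h3]; abel
  exact (sub_eq_zero.mp h4).symm

theorem aux_JW (md : ModularData ℋ H) {k : ℋ} (hk : k ∈ H) :
    md.J (md.W k) = k - md.R k := by
  have h2 := (md.memH_iff k).1 hk
  exact eq_sub_of_add_eq' h2

theorem aux_W_mem (md : ModularData ℋ H) {k : ℋ} (hk : k ∈ H) : md.W k ∈ H := by
  rw [md.memH_iff, md.W_sq, map_sub]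
  simp only [md.J_R, map_sub, aux_RJ md hk]
  abel

theorem aux_orth (md : ModularData ℋ H) {k h : ℋ} (hk : k ∈ H) (hh : h ∈ H) :
    ⟪md.J k, h⟫_ℝ = 2 * ⟪md.W k, h⟫_ℝ := by
  conv_lhs => rw [← (md.memH_iff h).1 hh]
  rw [inner_add_right, ← aux_R_sym, aux_RJ md hk, aux_J_sym, md.J_invol, ← aux_W_sym]
  ring

theorem aux_D_mem (md : ModularData ℋ H) {k : ℋ} (hk : k ∈ H) :
    Complex.I • (k - (2 : ℝ) • md.R k) ∈ H := by
  have h1 := aux_JW md hk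
  have h2 : md.J (md.W (md.R k)) = k - (2 : ℝ) • md.R k + md.R (md.R k) := by
    rw [md.WR_comm, md.J_R, h1, map_sub, two_smul]
    abel
  have h3 : ∀ x, md.W ((2 : ℝ) • x) = (2 : ℝ) • md.W x := fun x => by
    simp only [two_smul, map_add]
  have h4 : ∀ x, md.R ((2 : ℝ) • x) = (2 : ℝ) • md.R x := fun x => by
    simp only [two_smul, map_add]
  rw [md.memH_iff, map_smul, map_smul, md.J_conjI, map_sub, map_sub, map_sub, h3, h4,
    map_smul, h1, h2, ← sub_eq_add_neg, ← smul_sub]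
  congr 1
  simp only [two_smul]
  abel

theorem aux_im (x y : ℋ) : (⟪x, y⟫_ℂ).im = ⟪Complex.I • x, y⟫_ℝ := by
  rw [real_inner_eq_re_inner ℂ, inner_smul_left]
  simp

theorem aux_im_comm (x y : ℋ) : (⟪x, y⟫_ℂ).im = -(⟪y, x⟫_ℂ).im := by
  rw [← inner_conj_symm, Complex.conj_im]

theorem aux_im_zero (md : ModularData ℋ H) {h k : ℋ} (hh : h ∈ H) (hk : k ∈ H) :
    (⟪h, k - md.R k⟫_ℂ).im = 0 := by
  have h1 : (⟪h, k - md.R k⟫_ℂ).im = (⟪k, h - md.R h⟫_ℂ).im := by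
    rw [← aux_JW md hk, ← aux_JW md hh, aux_im, ← aux_J_sym, md.J_conjI, inner_neg_left,
      ← aux_im, ← md.W_sa, ← md.J_W, aux_im_comm, neg_neg]
  have h2 : (⟪k, h - md.R h⟫_ℂ).im = -(⟪h, k - md.R k⟫_ℂ).im := by
    rw [aux_im_comm, inner_sub_left, inner_sub_right, md.R_sa]
  linarith

theorem aux_orthproj {K : Submodule ℝ ℋ} {E : ℋ →ₗ[ℝ] ℋ} (hE : IsOrthProj K E) {x p : ℋ}
    (hp : p ∈ K) (hx : ∀ k ∈ K, ⟪x - p, k⟫_ℝ = 0) : E x = p := by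
  have h1 := hE.2.2 x (E x - p) (K.sub_mem (hE.1 x) hp)
  have h2 := hx (E x - p) (K.sub_mem (hE.1 x) hp)
  have h3 : ⟪E x - p, E x - p⟫_ℝ = 0 := by
    have : E x - p = (x - p) - (x - E x) := by abel
    conv_lhs => arg 2; rw [this]
    rw [inner_sub_left, h1, h2, sub_zero]
  exact sub_eq_zero.mp (inner_self_eq_zero.mp h3)

end ModularAux

theorem orthogonal_projections_symplectic_matrices
    {ℋ : Type} [NormedAddCommGroup ℋ] [InnerProductSpace ℂ ℋ] [CompleteSpace ℋ]
    (H : Submodule ℝ ℋ) (hH : IsClosed (H : Set ℋ))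
    (hcyc : Dense ((H ⊔ H.map (mulI ℋ) : Submodule ℝ ℋ) : Set ℋ))
    (hsep : H ⊓ H.map (mulI ℋ) = ⊥)
    (hfac : H ⊓ sympComp H = ⊥)
    (md : ModularData ℋ H)
    (D Q : ↥H →L[ℝ] ↥H)
    (hD : ∀ h k : ↥H, (⟪(h : ℋ), (k : ℋ)⟫_ℂ).im = ⟪(h : ℋ), ((D k : ↥H) : ℋ)⟫_ℝ)
    (hQsym : ∀ h k : ↥H, ⟪((Q h : ↥H) : ℋ), (k : ℋ)⟫_ℝ = ⟪(h : ℋ), ((Q k : ↥H) : ℋ)⟫_ℝ)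
    (hQpos : ∀ h : ↥H, 0 ≤ ⟪(h : ℋ), ((Q h : ↥H) : ℋ)⟫_ℝ)
    (hQsq : ∀ h : ↥H, Q (Q h) = h + D (D h))
    (E Eperp E' : ℋ →ₗ[ℝ] ℋ)
    (hE : IsOrthProj H E) (hEperp : IsOrthProj Hᗮ Eperp)
    (hE' : IsOrthProj (sympComp H) E') :
    -- E_H = [[1, √(1+D²) J], [0, 0]]
    (∀ (h jh' : ↥H) (h' : ℋ), h' ∈ sympComp H → (jh' : ℋ) = md.J h' →
        E ((h : ℋ) + h') = (h : ℋ) + ((Q jh' : ↥H) : ℋ)) ∧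
    -- E_{H^⊥} = [[0, −√(1+D²) J], [0, 1]]
    (∀ (h jh' : ↥H) (h' : ℋ), h' ∈ sympComp H → (jh' : ℋ) = md.J h' →
        Eperp ((h : ℋ) + h') = -((Q jh' : ↥H) : ℋ) + h') ∧
    -- E_{H'} = [[0, 0], [J √(1+D²), 1]]
    (∀ (h : ↥H) (h' : ℋ), h' ∈ sympComp H →
        E' ((h : ℋ) + h') = md.J ((Q h : ↥H) : ℋ) + h') := by
  have hDk : ∀ k : ↥H, ((D k : ↥H) : ℋ) = Complex.I • ((k : ℋ) - (2 : ℝ) • md.R k) := by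
    intro k
    have hm := aux_D_mem md k.2
    set v : ↥H := ⟨_, hm⟩ with hv
    suffices D k = v from congrArg Subtype.val this
    refine ext_inner_left ℝ fun h => ?_
    change ⟪(h : ℋ), ((D k : ↥H) : ℋ)⟫_ℝ = ⟪(h : ℋ), Complex.I • ((k : ℋ) - (2 : ℝ) • md.R k)⟫_ℝ
    rw [← hD]
    have h0 := aux_im_zero md h.2 k.2
    rw [real_inner_eq_re_inner ℂ, inner_smul_right, two_smul]
    simp only [inner_sub_right, inner_add_right, Complex.sub_im, Complex.add_im] at h0 ⊢
    simp
    linarith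
  have hDD : ∀ k : ↥H, ((k + D (D k) : ↥H) : ℋ) = (4 : ℝ) • md.W (md.W k) := by
    intro k
    have h4 : ∀ x, md.R ((2 : ℝ) • x) = (2 : ℝ) • md.R x := fun x => by
      simp only [two_smul, map_add]
    have h5 : ∀ x : ℋ, (4 : ℝ) • x = (2 : ℝ) • (2 : ℝ) • x := fun x => by
      rw [smul_smul]; norm_num
    rw [Submodule.coe_add, hDk, hDk, md.W_sq, h5, map_smul, map_sub, h4,
      smul_comm (2 : ℝ) Complex.I, ← smul_sub, smul_smul, Complex.I_mul_I]
    simp only [two_smul, neg_smul, one_smul]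
    abel
  let T : ↥H →L[ℝ] ↥H :=
    (((2 : ℝ) • (md.W.restrictScalars ℝ)).comp H.subtypeL).codRestrict H
      (fun k => H.smul_mem 2 (aux_W_mem md k.2))
  have hT : ∀ k : ↥H, ((T k : ↥H) : ℋ) = (2 : ℝ) • md.W k := fun k => rfl
  have hQT : Q = T := by
    refine aux_pos_sqrt_unique Q T (fun x y => hQsym x y) (fun x y => ?_) (fun x => hQpos x)
      (fun x => ?_) (fun x => ?_)
    · change ⟪(2 : ℝ) • md.W x, (y : ℋ)⟫_ℝ = ⟪(x : ℋ), (2 : ℝ) • md.W y⟫_ℝ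
      rw [real_inner_smul_left, real_inner_smul_right, aux_W_sym]
    · change 0 ≤ ⟪(x : ℋ), (2 : ℝ) • md.W x⟫_ℝ
      rw [real_inner_smul_right, real_inner_eq_re_inner ℂ]
      exact mul_nonneg zero_le_two (md.W_pos x)
    · rw [hQsq]
      apply Subtype.ext
      rw [hDD, hT, hT]
      simp only [two_smul, map_add]
      rw [show (4 : ℝ) = 2 + 2 by norm_num, add_smul, two_smul]
  have hQ : ∀ k : ↥H, ((Q k : ↥H) : ℋ) = (2 : ℝ) • md.W k := fun k => by rw [hQT, hT]
  have horth : ∀ k h : ↥H, ⟪md.J k - ((Q k : ↥H) : ℋ), (h : ℋ)⟫_ℝ = 0 := by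
    intro k h
    rw [hQ, inner_sub_left, real_inner_smul_left, aux_orth md k.2 h.2, sub_self]
  have hJ : ∀ (k : ↥H) (h' : ℋ), (k : ℋ) = md.J h' → md.J k = h' := by
    intro k h' e
    rw [e, md.J_invol]
  refine ⟨fun h k h' hh' e => ?_, fun h k h' hh' e => ?_, fun h h' hh' => ?_⟩
  · refine aux_orthproj hE (H.add_mem h.2 (Q k).2) fun x hx => ?_
    have := horth k ⟨x, hx⟩
    rw [hJ k h' e] at this
    rw [add_sub_add_left_eq_sub]
    exact this
  · refine aux_orthproj hEperp ?_ fun x hx => ?_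
    · rw [Submodule.mem_orthogonal']
      intro x hx
      have := horth k ⟨x, hx⟩
      rw [hJ k h' e] at this
      rw [neg_add_eq_sub]
      exact this
    · have e2 : (h : ℋ) + h' - (-((Q k : ↥H) : ℋ) + h') = ((h + Q k : ↥H) : ℋ) := by
        rw [Submodule.coe_add]; abel
      rw [e2]
      exact (Submodule.mem_orthogonal _ _).1 hx _ (h + Q k).2
  · refine aux_orthproj hE' ((sympComp H).add_mem (md.J_mapsH _ (Q h).2) hh') fun x hx => ?_
    rw [add_sub_add_right_eq_sub]
    have := horth h ⟨_, md.J_mapsH' x hx⟩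
    change ⟪md.J h - ((Q h : ↥H) : ℋ), md.J x⟫_ℝ = 0 at this
    rw [← aux_J_sym, map_sub, md.J_invol] at this
    exact this
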